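/- arXiv:2510.07183 — 6 statements merged into one kernel-verified Lean document; each statement's English description precedes it below -/
import Mathlib

section
/- Let q ≥ 1 and let ε(X) = ∑_{m=1}^M p_m U_m X U_m† be a mixed-unitary channel on M_q(ℂ) with M terms. If ε is the completely depolarizing channel, i.e., ε(X) = (tr X / q)·I for every X ∈ M_q(ℂ), then M ≥ q² (coherent dimension bound). -/
open Matrix

/-- **Coherent dimension bound.** A mixed-unitary channel on `M_q(ℂ)` that equals the
completely depolarizing channel must involve at least `q²` unitaries. -/
theorem coherent_dimension_bound
    (q : ℕ) (hq : 1 ≤ q) (M : ℕ)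
    (p : Fin M → ℝ) (hp : ∀ m, 0 < p m) (hpsum : ∑ m, p m = 1)
    (U : Fin M → Matrix (Fin q) (Fin q) ℂ)
    (hU : ∀ m, (U m)ᴴ * U m = 1)
    (hdep : ∀ X : Matrix (Fin q) (Fin q) ℂ,
      ∑ m, p m • (U m * X * (U m)ᴴ) = (X.trace / (q : ℂ)) • (1 : Matrix (Fin q) (Fin q) ℂ)) :
    q ^ 2 ≤ M := by
  have hq0 : (q : ℂ) ≠ 0 := by exact_mod_cast (by omega : q ≠ 0)
  let A : Matrix (Fin q × Fin q) (Fin M) ℂ := .of fun a m => U m a.1 a.2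
  let B : Matrix (Fin M) (Fin q × Fin q) ℂ := .of fun m b => q * (p m * star (U m b.1 b.2))
  have hAB : A * B = 1 := by
    ext ⟨i, j⟩ ⟨k, l⟩
    have h := congrFun (congrFun (hdep (Matrix.single j l 1)) i) k
    have hterm : ∀ m, (U m * Matrix.single j l (1 : ℂ) * (U m)ᴴ) i k
        = U m i j * star (U m k l) := by
      intro m
      simp [Matrix.mul_apply, Matrix.single_apply, Finset.sum_ite_eq, ite_and]
    simp only [Matrix.sum_apply, Matrix.smul_apply, hterm] at h
    have hsum : (A * B) (i, j) (k, l) = q * ∑ m, p m • (U m i j * star (U m k l)) := by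
      simp only [A, B, Matrix.mul_apply, Matrix.of_apply, Finset.mul_sum, Complex.real_smul]
      exact Finset.sum_congr rfl fun m _ => by ring
    rw [hsum, h]
    by_cases hjl : j = l
    · subst hjl
      by_cases hik : i = k <;> simp [Matrix.one_apply, hik, hq0]
    · simp [Matrix.one_apply, hjl, Matrix.trace_single_eq_of_ne]
  have hrank := Matrix.rank_mul_le_left A B
  rw [hAB, Matrix.rank_one] at hrank
  simpa [sq] using hrank.trans A.rank_le_card_width
end

section
/- Let q ≥ 1 and let ε(X) = ∑_{m=1}^M p_m U_m X U_m† be a mixed-unitary channel on M_q(ℂ) with M terms. If ε(X) = (tr X / q)·I for every X ∈ M_q(ℂ), then the unitaries U_1, …, U_M span M_q(ℂ) as a complex vector space. -/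
open Matrix

/-- If a mixed-unitary channel on `M_q(ℂ)` is the completely depolarizing channel, then its
unitaries span `M_q(ℂ)` as a complex vector space. -/
theorem depolarizing_unitaries_span
    (q : ℕ) (hq : 1 ≤ q) (M : ℕ)
    (p : Fin M → ℝ) (hp : ∀ m, 0 < p m) (hpsum : ∑ m, p m = 1)
    (U : Fin M → Matrix (Fin q) (Fin q) ℂ)
    (hU : ∀ m, (U m)ᴴ * U m = 1)
    (hdep : ∀ X : Matrix (Fin q) (Fin q) ℂ,
      ∑ m, p m • (U m * X * (U m)ᴴ) = (X.trace / (q : ℂ)) • (1 : Matrix (Fin q) (Fin q) ℂ)) :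
    Submodule.span ℂ (Set.range U) = (⊤ : Submodule ℂ (Matrix (Fin q) (Fin q) ℂ)) := by
  have hq0 : (q : ℂ) ≠ 0 := by exact_mod_cast (Nat.one_le_iff_ne_zero.mp hq)
  have entries (a b i j : Fin q) :
      ∑ m, (p m : ℂ) * (U m i j * star (U m a b))
        = (if j = b then 1 else 0) / (q : ℂ) * (if i = a then 1 else 0) := by
    have h := congrFun (congrFun (hdep (Matrix.single j b 1)) i) a
    simpa [Matrix.sum_apply, Matrix.mul_apply, Matrix.single_apply, Matrix.trace, Matrix.one_apply,
      ite_and, Finset.sum_ite_eq, eq_comm] using h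
  have single_mem (a b : Fin q) :
      Matrix.single a b (1 : ℂ) ∈ Submodule.span ℂ (Set.range U) := by
    have h : Matrix.single a b (1 : ℂ) = ∑ m, ((q : ℂ) * p m * star (U m a b)) • U m := by
      ext i j
      have e : ∑ m, (q : ℂ) * p m * star (U m a b) * U m i j
          = q * ∑ m, (p m : ℂ) * (U m i j * star (U m a b)) := by
        rw [Finset.mul_sum]
        exact Finset.sum_congr rfl fun m _ => by ring
      simp only [Matrix.sum_apply, Matrix.smul_apply, smul_eq_mul]
      rw [e, entries, Matrix.single_apply]
      by_cases h₁ : i = a <;> by_cases h₂ : j = b <;>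
        simp [h₁, h₂, hq0, eq_comm (a := a), eq_comm (a := b)]
    rw [h]
    exact Submodule.sum_mem _ fun m _ =>
      Submodule.smul_mem _ _ (Submodule.subset_span ⟨m, rfl⟩)
  refine eq_top_iff.mpr fun A _ => ?_
  rw [Matrix.matrix_eq_sum_single A]
  refine Submodule.sum_mem _ fun a _ => Submodule.sum_mem _ fun b _ => ?_
  simpa [Matrix.smul_single] using Submodule.smul_mem _ (A a b) (single_mem a b)
end

section
/- Let N ≥ 1 and d = 2^N. Let ε(X) = ∑_{m=1}^M p_m U_m X U_m† be a mixed-unitary channel on M_d(ℂ) with M terms such that ε(X) = 0 for every traceless X ∈ M_d(ℂ). Then M ≥ 4^N (no-go for full universal robustness). -/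
open Matrix

/-- A matrix with a right inverse has at least as many columns as rows. -/
theorem Matrix.card_le_card_of_mul_eq_one {m n K : Type*} [Fintype m] [Fintype n] [DecidableEq m]
    [Field K] {A : Matrix m n K} {B : Matrix n m K} (h : A * B = 1) :
    Fintype.card m ≤ Fintype.card n := by
  calc Fintype.card m = (A * B).rank := by rw [h, rank_one]
    _ ≤ A.rank := rank_mul_le_left A B
    _ ≤ Fintype.card n := rank_le_card_width A

/-- A mixed-unitary channel annihilating traceless matrices sends every `X` to
`(X.trace / d) • 1`. -/
theorem mixedUnitary_apply_eq_trace_smul_one {n ι : Type*} [Fintype n] [DecidableEq n] [Nonempty n]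
    [Fintype ι] {p : ι → ℝ} (hpsum : ∑ m, p m = 1) {U : ι → Matrix n n ℂ}
    (hU : ∀ m, (U m)ᴴ * U m = 1)
    (hrob : ∀ X : Matrix n n ℂ, X.trace = 0 → ∑ m, p m • (U m * X * (U m)ᴴ) = 0)
    (X : Matrix n n ℂ) :
    ∑ m, p m • (U m * X * (U m)ᴴ) = (X.trace / Fintype.card n) • (1 : Matrix n n ℂ) := by
  have hd : (Fintype.card n : ℂ) ≠ 0 := Nat.cast_ne_zero.mpr Fintype.card_ne_zero
  have hX := hrob (X - (X.trace / Fintype.card n) • 1) (by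
    rw [trace_sub, trace_smul, trace_one, smul_eq_mul, div_mul_cancel₀ _ hd, sub_self])
  have hU' : ∀ m, U m * (U m)ᴴ = 1 := fun m => mul_eq_one_comm.mp (hU m)
  simp only [mul_sub, sub_mul, smul_sub, Finset.sum_sub_distrib, mul_smul_comm, smul_mul_assoc,
    mul_one, hU', ← Finset.sum_smul, hpsum, one_smul] at hX
  exact sub_eq_zero.mp hX

/-- A mixed-unitary channel annihilating traceless `d × d` matrices has at least `d ^ 2` terms. -/
theorem sq_card_le_card_of_mixedUnitary_traceless_eq_zero {n ι : Type*} [Fintype n] [DecidableEq n]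
    [Nonempty n] [Fintype ι] {p : ι → ℝ} (hpsum : ∑ m, p m = 1) {U : ι → Matrix n n ℂ}
    (hU : ∀ m, (U m)ᴴ * U m = 1)
    (hrob : ∀ X : Matrix n n ℂ, X.trace = 0 → ∑ m, p m • (U m * X * (U m)ᴴ) = 0) :
    Fintype.card n ^ 2 ≤ Fintype.card ι := by
  have hd : (Fintype.card n : ℂ) ≠ 0 := Nat.cast_ne_zero.mpr Fintype.card_ne_zero
  let A : Matrix (n × n) ι ℂ := of fun a m => U m a.1 a.2
  let B : Matrix ι (n × n) ℂ := of fun m b => Fintype.card n * (p m * star (U m b.1 b.2))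
  have hAB : A * B = 1 := by
    ext ⟨i, j⟩ ⟨k, l⟩
    have h := congrFun₂
      (mixedUnitary_apply_eq_trace_smul_one hpsum hU hrob (Matrix.single j l 1)) i k
    have hterm : ∀ m : ι,
        (U m * Matrix.single j l 1 * (U m)ᴴ : Matrix n n ℂ) i k = U m i j * star (U m k l) := by
      intro m
      simp [mul_apply, single_apply, ite_and]
    simp only [Matrix.sum_apply, Matrix.smul_apply, hterm] at h
    have hsum : (A * B) (i, j) (k, l)
        = Fintype.card n * ∑ m, p m • (U m i j * star (U m k l)) := by
      simp only [A, B, mul_apply, of_apply, Finset.mul_sum, Complex.real_smul]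
      exact Finset.sum_congr rfl fun m _ => by ring
    rw [hsum, h]
    by_cases hjl : j = l <;> by_cases hik : i = k <;>
      simp [one_apply, hjl, hik, hd, trace_single_eq_same, trace_single_eq_of_ne]
  simpa [sq] using card_le_card_of_mul_eq_one hAB

/-- **No-go for full universal robustness.** For `N` qubits (`d = 2^N`), a mixed-unitary
channel annihilating every traceless operator must have at least `4^N` terms. -/
theorem no_go_full_universal_robustness
    (N : ℕ) (hN : 1 ≤ N) (M : ℕ)
    (p : Fin M → ℝ) (hp : ∀ m, 0 < p m) (hpsum : ∑ m, p m = 1)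
    (U : Fin M → Matrix (Fin (2 ^ N)) (Fin (2 ^ N)) ℂ)
    (hU : ∀ m, (U m)ᴴ * U m = 1)
    (hrob : ∀ X : Matrix (Fin (2 ^ N)) (Fin (2 ^ N)) ℂ, X.trace = 0 →
      ∑ m, p m • (U m * X * (U m)ᴴ) = 0) :
    4 ^ N ≤ M := by
  have h := sq_card_le_card_of_mixedUnitary_traceless_eq_zero hpsum hU hrob
  rw [Fintype.card_fin, Fintype.card_fin, ← pow_mul, mul_comm, pow_mul] at h
  exact h
end

section
/- Let d ≥ 2 be even, let V ∈ M_d(ℂ) be Hermitian with V² = I and tr V = 0, and let E ∈ M_d(ℂ) be Hermitian with tr E = 0. Then there exist an integer m with m ≤ d+1, Hermitian matrices K_1, …, K_m ∈ M_d(ℂ) with K_j² = I for each j, and real numbers α, γ, β_2, …, β_m such that α·V + γ·i(K_1 V − V K_1) + ∑_{j=2}^m β_j · K_j V K_j = E (at most d+1 correctors suffice to cancel a given first-order error). -/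
open Matrix

namespace Matrix

variable {n : Type*} [Fintype n] [DecidableEq n]

/-- The pseudo-inverse `R` of `|T|`, for a Hermitian matrix `T`. -/
theorem IsHermitian.exists_abs_inverse {T : Matrix n n ℂ} (hT : T.IsHermitian) :
    ∃ R : Matrix n n ℂ, R.IsHermitian ∧ (∀ X, Commute (T * T) X → Commute R X) ∧
      T * T * (R * R) * T = T := by
  have hsa : IsSelfAdjoint T := hT
  have hc : ∀ f : ℝ → ℝ, ContinuousOn f (spectrum ℝ T) :=
    fun f ↦ T.finite_real_spectrum.continuousOn f
  have hR : cfc (fun x : ℝ ↦ |x|⁻¹) T = cfc (fun x : ℝ ↦ (√x)⁻¹) (T * T) := by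
    rw [← pow_two, ← cfc_comp_pow (fun x : ℝ ↦ (√x)⁻¹) 2 T
      ((T.finite_real_spectrum.image _).continuousOn _)]
    simp only [Real.sqrt_sq_eq_abs]
  refine ⟨cfc (fun x : ℝ ↦ |x|⁻¹) T, cfc_predicate _ T, fun X hX ↦ ?_, ?_⟩
  · rw [hR]
    exact hX.cfc_real _
  · have hid : cfc (fun x : ℝ ↦ x) T = T := cfc_id' ℝ T
    calc _ = cfc (fun x : ℝ ↦ x * x * (|x|⁻¹ * |x|⁻¹) * x) T := by
          rw [cfc_mul _ _ T (hc _) (hc _), cfc_mul _ _ T (hc _) (hc _), cfc_mul _ _ T (hc _) (hc _),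
            cfc_mul _ _ T (hc _) (hc _), hid]
      _ = cfc (fun x : ℝ ↦ x) T := by
          congr 1
          ext x
          rcases eq_or_ne x 0 with rfl | hx
          · simp
          · rw [← mul_inv, abs_mul_abs_self]
            field_simp
      _ = T := hid

theorem IsHermitian.exists_unitary_diagonal {A : Matrix n n ℂ} (hA : A.IsHermitian) :
    ∃ (U : Matrix n n ℂ) (t : n → ℝ), Uᴴ * U = 1 ∧ U * Uᴴ = 1 ∧
      A = U * diagonal (fun i ↦ (t i : ℂ)) * Uᴴ := by
  refine ⟨hA.eigenvectorUnitary.1, hA.eigenvalues, Unitary.coe_star_mul_self _,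
    Unitary.coe_mul_star_self _, ?_⟩
  conv_lhs => rw [hA.spectral_theorem, Unitary.conjStarAlgAut_apply]
  rfl

/-- A Hermitian idempotent is `M Mᴴ` for an isometry `M` whose number of columns is its trace. -/
theorem exists_isometry_of_isHermitian_of_mul_self {A : Matrix n n ℂ}
    (hA : A.IsHermitian) (hA2 : A * A = A) :
    ∃ (k : ℕ) (M : Matrix n (Fin k) ℂ), A.trace = k ∧ M * Mᴴ = A ∧ Mᴴ * M = 1 := by
  obtain ⟨U, t, hUU, hUU', hspec⟩ := hA.exists_unitary_diagonal
  have ht : ∀ i, t i = 0 ∨ t i = 1 := by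
    have hD : diagonal (fun i ↦ (t i : ℂ)) = Uᴴ * A * U := by
      rw [hspec, Matrix.mul_assoc, Matrix.mul_assoc, Matrix.mul_assoc, hUU, Matrix.mul_one,
        ← Matrix.mul_assoc, hUU, Matrix.one_mul]
    have hDD : diagonal (fun i ↦ (t i : ℂ)) * diagonal (fun i ↦ (t i : ℂ))
        = diagonal (fun i ↦ (t i : ℂ)) := by
      rw [hD]
      calc _ = Uᴴ * A * (U * Uᴴ) * A * U := by simp only [Matrix.mul_assoc]
        _ = Uᴴ * (A * A) * U := by rw [hUU']; simp only [Matrix.mul_assoc, Matrix.one_mul]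
        _ = _ := by rw [hA2]
    intro i
    have hi := congr_fun₂ hDD i i
    simp only [diagonal_mul_diagonal, diagonal_apply_eq] at hi
    have hi' : t i * t i = t i := by exact_mod_cast hi
    exact IsIdempotentElem.iff_eq_zero_or_one.mp hi'
  let e := (Fintype.equivFin {i // t i = 1}).symm
  let M : Matrix n _ ℂ := U.submatrix id (fun j ↦ (e j : n))
  have hMM : M * Mᴴ = A := by
    rw [hspec]
    ext a b
    simp only [M, mul_apply, submatrix_apply, id, conjTranspose_apply, diagonal_apply, mul_ite,
      mul_zero, Finset.sum_ite_eq', Finset.mem_univ, if_true]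
    rw [e.sum_comp (fun j : {i // t i = 1} ↦ U a j * star (U b j)),
      ← Finset.sum_subtype (Finset.univ.filter (fun i ↦ t i = 1)) (by simp)
        (fun i ↦ U a i * star (U b i)), Finset.sum_filter]
    refine Finset.sum_congr rfl fun i _ ↦ ?_
    rcases ht i with h | h <;> simp [h]
  have hM1 : Mᴴ * M = 1 := by
    ext a b
    have := congr_fun₂ hUU (e a) (e b)
    simpa [M, mul_apply, one_apply, Subtype.coe_inj] using this
  refine ⟨_, M, ?_, hMM, hM1⟩
  rw [← hMM, trace_mul_comm, hM1, trace_one, Fintype.card_fin]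

/-- Hermitian idempotents of equal trace are linked by a partial isometry. -/
theorem exists_partial_isometry_of_trace_eq {A B : Matrix n n ℂ} (hA : A.IsHermitian)
    (hA2 : A * A = A) (hB : B.IsHermitian) (hB2 : B * B = B) (h : A.trace = B.trace) :
    ∃ X : Matrix n n ℂ, X * Xᴴ = A ∧ Xᴴ * X = B := by
  obtain ⟨k, M, hk, hMA, hM⟩ := exists_isometry_of_isHermitian_of_mul_self hA hA2
  obtain ⟨l, N, hl, hNB, hN⟩ := exists_isometry_of_isHermitian_of_mul_self hB hB2
  obtain rfl : k = l := by
    rw [hk, hl] at h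
    exact_mod_cast h
  refine ⟨M * Nᴴ, ?_, ?_⟩
  · rw [conjTranspose_mul, conjTranspose_conjTranspose, ← Matrix.mul_assoc, Matrix.mul_assoc M, hN,
      Matrix.mul_one, hMA]
  · rw [conjTranspose_mul, conjTranspose_conjTranspose, ← Matrix.mul_assoc, Matrix.mul_assoc N, hM,
      Matrix.mul_one, hNB]

open scoped ComplexOrder in
/-- If `V` is a Hermitian involution that commutes with a Hermitian idempotent `P` and
`tr (P V) = 0`, then some Hermitian `L` with `L² = P` anticommutes with `V`. -/
theorem exists_anticommuting {P V : Matrix n n ℂ} (hP : P.IsHermitian) (hP2 : P * P = P)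
    (hV : V.IsHermitian) (hV2 : V * V = 1) (hPV : P * V = V * P) (htr : (P * V).trace = 0) :
    ∃ L : Matrix n n ℂ, L.IsHermitian ∧ L * L = P ∧ V * L = -(L * V) := by
  have hPVPV : P * V * (P * V) = P := by
    calc P * V * (P * V) = P * (V * P) * V := by noncomm_ring
      _ = P * P * (V * V) := by rw [← hPV]; noncomm_ring
      _ = P := by rw [hP2, hV2, mul_one]
  have hPPV : P * (P * V) = P * V := by rw [← mul_assoc, hP2]
  have hPVP : P * V * P = P * V := by rw [mul_assoc, ← hPV, hPPV]
  have hPVH : (P * V)ᴴ = P * V := by rw [conjTranspose_mul, hP.eq, hV.eq, hPV]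
  set A : Matrix n n ℂ := (1 / 2 : ℂ) • (P + P * V) with hA
  set B : Matrix n n ℂ := (1 / 2 : ℂ) • (P - P * V) with hB
  have hAH : A.IsHermitian := by
    rw [IsHermitian, hA, conjTranspose_smul, conjTranspose_add, hP.eq, hPVH]; simp
  have hBH : B.IsHermitian := by
    rw [IsHermitian, hB, conjTranspose_smul, conjTranspose_sub, hP.eq, hPVH]; simp
  have hAA : A * A = A := by
    simp only [hA, smul_mul_smul_comm, mul_add, add_mul, hP2, hPVPV, hPPV, hPVP]
    module
  have hBB : B * B = B := by
    simp only [hB, smul_mul_smul_comm, mul_sub, sub_mul, hP2, hPVPV, hPPV, hPVP]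
    module
  have hBA : B * A = 0 := by
    simp only [hA, hB, smul_mul_smul_comm, mul_add, sub_mul, hP2, hPVPV, hPPV, hPVP]
    module
  have hAB : A + B = P := by
    rw [hA, hB]; module
  have hVA : V * A = A := by
    have : V * (P * V) = P := by rw [← mul_assoc, ← hPV, mul_assoc, hV2, mul_one]
    rw [hA, mul_smul_comm, mul_add, this, ← hPV, add_comm]
  have hVB : V * B = -B := by
    have : V * (P * V) = P := by rw [← mul_assoc, ← hPV, mul_assoc, hV2, mul_one]
    rw [hB, mul_smul_comm, mul_sub, this, ← hPV, ← smul_neg, neg_sub]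
  have htrAB : A.trace = B.trace := by
    rw [hA, hB, trace_smul, trace_smul, trace_add, trace_sub, htr, add_zero, sub_zero]
  obtain ⟨X, hXA, hXB⟩ := exists_partial_isometry_of_trace_eq hAH hAA hBH hBB htrAB
  have hAX : A * X = X := by
    have h0 : (A * X - X) * (A * X - X)ᴴ = 0 := by
      calc _ = (A - 1) * (X * Xᴴ) * (A - 1)ᴴ := by
            rw [show A * X - X = (A - 1) * X by noncomm_ring, conjTranspose_mul]; noncomm_ring
        _ = 0 := by rw [hXA, sub_mul, one_mul, hAA, sub_self, zero_mul]
    exact sub_eq_zero.mp (self_mul_conjTranspose_eq_zero.mp h0)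
  have hXB' : X * B = X := by rw [← hXB, ← mul_assoc, hXA, hAX]
  have hVX : V * X = X := by rw [← hAX, ← mul_assoc, hVA]
  have hXHA : Xᴴ * A = Xᴴ := by
    simpa only [conjTranspose_mul, hAH.eq] using congr_arg conjTranspose hAX
  have hBXH : B * Xᴴ = Xᴴ := by
    simpa only [conjTranspose_mul, hBH.eq] using congr_arg conjTranspose hXB'
  have hVXH : V * Xᴴ = -Xᴴ := by rw [← hBXH, ← mul_assoc, hVB, neg_mul]
  have hXHV : Xᴴ * V = Xᴴ := by
    simpa only [conjTranspose_mul, hV.eq] using congr_arg conjTranspose hVX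
  have hXV : X * V = -X := by
    simpa only [conjTranspose_mul, hV.eq, conjTranspose_neg, conjTranspose_conjTranspose]
      using congr_arg conjTranspose hVXH
  have hXX : X * X = 0 := by
    calc X * X = X * B * (A * X) := by rw [hXB', hAX]
      _ = X * (B * A) * X := by noncomm_ring
      _ = 0 := by rw [hBA, mul_zero, zero_mul]
  have hXXH : Xᴴ * Xᴴ = 0 := by rw [← conjTranspose_mul, hXX, conjTranspose_zero]
  refine ⟨X + Xᴴ, ?_, ?_, ?_⟩
  · rw [IsHermitian, conjTranspose_add, conjTranspose_conjTranspose, add_comm]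
  · rw [mul_add, add_mul, add_mul, hXX, hXXH, hXA, hXB, zero_add, add_zero, add_comm, hAB]
  · rw [mul_add, add_mul, hVX, hVXH, hXV, hXHV]
    abel

open scoped ComplexOrder in
/-- Two Hermitian involutions with zero trace are conjugate by a Hermitian involution. -/
theorem exists_involution_conj_eq {V W : Matrix n n ℂ} (hV : V.IsHermitian) (hV2 : V * V = 1)
    (hVtr : V.trace = 0) (hW : W.IsHermitian) (hW2 : W * W = 1) (hWtr : W.trace = 0) :
    ∃ K : Matrix n n ℂ, K.IsHermitian ∧ K * K = 1 ∧ K * V * K = W := by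
  obtain ⟨T, hT⟩ : ∃ T, T = V + W := ⟨_, rfl⟩
  have hTH : T.IsHermitian := hT ▸ hV.add hW
  have hVT : V * T = T * W := by rw [hT, mul_add, add_mul, hV2, hW2, add_comm]
  have hWT : W * T = T * V := by rw [hT, mul_add, add_mul, hV2, hW2, add_comm]
  have hTTV : Commute (T * T) V := by
    rw [Commute, SemiconjBy, mul_assoc, ← hWT, ← mul_assoc, ← hVT, mul_assoc]
  have hTTT : Commute (T * T) T := mul_assoc T T T
  obtain ⟨R, hR, hRcomm, hTRT⟩ := hTH.exists_abs_inverse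
  have hRV : R * V = V * R := hRcomm V hTTV
  have hRT : R * T = T * R := hRcomm T hTTT
  have hRW : R * W = W * R := by
    rw [show W = T - V by rw [hT]; abel, mul_sub, sub_mul, hRV, hRT]
  obtain ⟨S, hS⟩ : ∃ S, S = T * R := ⟨_, rfl⟩
  have hSH : S.IsHermitian := by
    rw [IsHermitian, hS, conjTranspose_mul, hTH.eq, hR.eq, hRT]
  have hVS : V * S = S * W := by rw [hS, ← mul_assoc, hVT, mul_assoc, ← hRW, mul_assoc]
  have hWS : W * S = S * V := by rw [hS, ← mul_assoc, hWT, mul_assoc, ← hRV, mul_assoc]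
  have hSS : S * S = T * T * (R * R) := by
    rw [hS]
    calc T * R * (T * R) = T * (R * T) * R := by noncomm_ring
      _ = _ := by rw [hRT]; noncomm_ring
  have hSST : S * S * T = T := by rw [hSS, hTRT]
  have hSSS : S * S * S = S := by
    conv_lhs => enter [2]; rw [hS]
    rw [← mul_assoc, hSST, hS]
  obtain ⟨P, hP⟩ : ∃ P, P = 1 - S * S := ⟨_, rfl⟩
  have hPH : P.IsHermitian := by
    rw [IsHermitian, hP, conjTranspose_sub, conjTranspose_one, conjTranspose_mul, hSH.eq]
  have hPS : P * S = 0 := by rw [hP, sub_mul, one_mul, hSSS, sub_self]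
  have hSP : S * P = 0 := by rw [hP, mul_sub, mul_one, ← mul_assoc, hSSS, sub_self]
  have hP2 : P * P = P := by
    conv_lhs => enter [2]; rw [hP]
    rw [mul_sub, mul_one, ← mul_assoc, hPS, zero_mul, sub_zero]
  have hPV : P * V = V * P := by
    rw [hP, sub_mul, mul_sub, one_mul, mul_one, mul_assoc, ← hWS, ← mul_assoc, ← hVS, mul_assoc]
  have hPT : P * T = 0 := by rw [hP, sub_mul, one_mul, hSST, sub_self]
  have hPW : P * W = -(P * V) := by
    rw [eq_neg_iff_add_eq_zero, ← mul_add, add_comm W, ← hT, hPT]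
  have htr : (P * V).trace = 0 := by
    have h1 : (P * V).trace = -(S * S * V).trace := by
      rw [hP, sub_mul, one_mul, trace_sub, hVtr, zero_sub]
    have h2 : (P * W).trace = -(S * S * V).trace := by
      rw [hP, sub_mul, one_mul, trace_sub, hWtr, zero_sub, mul_assoc, ← hVS, trace_mul_comm S,
        mul_assoc, trace_mul_comm V]
    rw [hPW, trace_neg] at h2
    linear_combination (h1 - h2) / 2
  obtain ⟨L, hL, hLL, hVL⟩ := exists_anticommuting hPH hP2 hV hV2 hPV htr
  have hLP : L * P = L := by
    have h0 : (L * P - L) * (L * P - L)ᴴ = 0 := by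
      rw [conjTranspose_sub, conjTranspose_mul, hL.eq, hPH.eq]
      calc _ = L * (P * P) * L - L * P * L - L * P * L + L * L := by noncomm_ring
        _ = L * L - L * L * (L * L) := by rw [hP2, ← hLL]; noncomm_ring
        _ = 0 := by rw [hLL, hP2, sub_self]
    exact sub_eq_zero.mp (self_mul_conjTranspose_eq_zero.mp h0)
  have hPL : P * L = L := by
    simpa only [conjTranspose_mul, hPH.eq, hL.eq] using congr_arg conjTranspose hLP
  have hSL : S * L = 0 := by rw [← hPL, ← mul_assoc, hSP, zero_mul]
  have hLS : L * S = 0 := by rw [← hLP, mul_assoc, hPS, mul_zero]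
  have hLW : L * W = V * L := by
    rw [hVL]
    conv_lhs => rw [← hLP]
    rw [mul_assoc, hPW, mul_neg, ← mul_assoc, hLP]
  have hKK : (S + L) * (S + L) = 1 := by
    rw [mul_add, add_mul, add_mul, hLS, hSL, hLL, hP]
    abel
  refine ⟨S + L, hSH.add hL, hKK, ?_⟩
  rw [mul_assoc, mul_add V, hVS, ← hLW, ← add_mul, ← mul_assoc, hKK, one_mul]

/-- Some balanced sign vector separates two given indices. -/
theorem exists_balanced_sign_vector (d : ℕ) (hd : Even d) (i j : Fin d) (hij : i ≠ j) :
    ∃ s : Fin d → ℝ, (∀ k, s k = 1 ∨ s k = -1) ∧ ∑ k, s k = 0 ∧ s i = 1 ∧ s j = -1 := by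
  have h2 : 1 < d := by have := i.2; have := j.2; rw [Ne, Fin.ext_iff] at hij; omega
  let a : Fin d := ⟨0, by omega⟩
  let b : Fin d := ⟨1, h2⟩
  let σ : Equiv.Perm (Fin d) := Equiv.swap (Equiv.swap i a j) b * Equiv.swap i a
  have hab : a ≠ b := by simp [a, b]
  have hi : σ i = a := by
    have : a ≠ Equiv.swap i a j := by
      intro h
      have : Equiv.swap i a i = Equiv.swap i a j := by rw [Equiv.swap_apply_left]; exact h
      exact hij ((Equiv.swap i a).injective this)
    simp [σ, Equiv.swap_apply_of_ne_of_ne this hab]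
  have hj : σ j = b := by simp [σ]
  refine ⟨fun k ↦ (-1) ^ (σ k : ℕ), fun k ↦ neg_one_pow_eq_or ℝ _, ?_, ?_, ?_⟩
  · rw [σ.sum_comp _ (fun k : Fin d ↦ (-1 : ℝ) ^ (k : ℕ)) (by simp),
      Fin.sum_univ_eq_sum_range (fun k ↦ (-1 : ℝ) ^ k) d, neg_one_geom_sum, if_pos hd]
  · simp [hi, a]
  · simp [hj, b]

/-- Vectors with zero sum are spanned by the balanced sign vectors. -/
theorem mem_span_balanced_of_sum_eq_zero {d : ℕ} (hd : Even d) (t : Fin d → ℝ)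
    (ht : ∑ k, t k = 0) :
    t ∈ Submodule.span ℝ {s : Fin d → ℝ | (∀ k, s k = 1 ∨ s k = -1) ∧ ∑ k, s k = 0} := by
  have hdiff : ∀ i j : Fin d, (Pi.single i 1 - Pi.single j 1 : Fin d → ℝ) ∈
      Submodule.span ℝ {s : Fin d → ℝ | (∀ k, s k = 1 ∨ s k = -1) ∧ ∑ k, s k = 0} := by
    intro i j
    rcases eq_or_ne i j with rfl | hij
    · rw [sub_self]
      exact Submodule.zero_mem _
    · obtain ⟨s, hs, hs0, hsi, hsj⟩ := exists_balanced_sign_vector d hd i j hij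
      have hs' : (∀ k, (s ∘ Equiv.swap i j) k = 1 ∨ (s ∘ Equiv.swap i j) k = -1) ∧
          ∑ k, (s ∘ Equiv.swap i j) k = 0 :=
        ⟨fun k ↦ hs _, by rw [← hs0]; exact (Equiv.swap i j).sum_comp _ s (by simp)⟩
      have heq : (Pi.single i 1 - Pi.single j 1 : Fin d → ℝ) =
          (1 / 2 : ℝ) • (s - s ∘ Equiv.swap i j) := by
        ext k
        rcases eq_or_ne k i with rfl | hki
        · simp [hij, hsi, hsj]; norm_num
        · rcases eq_or_ne k j with rfl | hkj
          · simp [hki, hsi, hsj]; norm_num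
          · simp [hki, hkj, Equiv.swap_apply_of_ne_of_ne hki hkj]
      rw [heq]
      exact Submodule.smul_mem _ _ (Submodule.sub_mem _ (Submodule.subset_span ⟨hs, hs0⟩)
        (Submodule.subset_span hs'))
  rcases Nat.eq_zero_or_pos d with rfl | hpos
  · rw [Subsingleton.elim t 0]
    exact Submodule.zero_mem _
  · have heq : t = ∑ k, t k • (Pi.single k 1 - Pi.single ⟨0, hpos⟩ 1 : Fin d → ℝ) := by
      simp_rw [smul_sub, Finset.sum_sub_distrib, ← Finset.sum_smul, ht, zero_smul, sub_zero]
      exact pi_eq_sum_univ' t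
    rw [heq]
    exact Submodule.sum_mem _ fun k _ ↦ Submodule.smul_mem _ _ (hdiff k _)

end Matrix

/-- A vector in the span of a set is a linear combination of at most `finrank` elements of it. -/
theorem Submodule.exists_sum_smul_eq_of_mem_span {𝕜 E : Type*} [Field 𝕜] [AddCommGroup E]
    [Module 𝕜 E] [FiniteDimensional 𝕜 E] {S : Set E} {x : E} (hx : x ∈ Submodule.span 𝕜 S) :
    ∃ m ≤ Module.finrank 𝕜 E, ∃ (v : Fin m → E) (β : Fin m → 𝕜),
      (∀ j, v j ∈ S) ∧ ∑ j, β j • v j = x := by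
  obtain ⟨b, hbS, hspan, hli⟩ := exists_linearIndependent 𝕜 S
  have : Fintype b := hli.setFinite.fintype
  rw [← hspan, ← Subtype.range_coe (s := b), Submodule.mem_span_range_iff_exists_fun] at hx
  obtain ⟨c, hc⟩ := hx
  let e := (Fintype.equivFin b).symm
  exact ⟨_, hli.fintype_card_le_finrank, fun j ↦ e j, fun j ↦ c (e j), fun j ↦ hbS (e j).2,
    by rw [← hc]; exact e.sum_comp fun i ↦ c i • (i : E)⟩

/-- **At most `d+1` correctors cancel a given first-order error.** For a traceless
Hermitian involution `V` and any traceless Hermitian `E` on `ℂ^d` (`d` even), there are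
Hermitian involutions `K_1, …, K_m` with `m ≤ d+1` and real coefficients
`α, γ, β_2, …, β_m` with `α V + γ · i[K_1, V] + ∑_{j≥2} β_j K_j V K_j = E`. -/
theorem correctors_cancel_error
    (d : ℕ) (hd : 2 ≤ d) (hdeven : Even d)
    (V : Matrix (Fin d) (Fin d) ℂ) (hV : V.IsHermitian) (hV2 : V * V = 1)
    (hVtr : V.trace = 0)
    (E : Matrix (Fin d) (Fin d) ℂ) (hE : E.IsHermitian) (hEtr : E.trace = 0) :
    ∃ (m : ℕ), m + 1 ≤ d + 1 ∧
      ∃ (K₁ : Matrix (Fin d) (Fin d) ℂ) (K : Fin m → Matrix (Fin d) (Fin d) ℂ)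
        (α γ : ℝ) (β : Fin m → ℝ),
        K₁.IsHermitian ∧ K₁ * K₁ = 1 ∧
        (∀ j, (K j).IsHermitian) ∧ (∀ j, K j * K j = 1) ∧
        α • V + γ • (Complex.I • (K₁ * V - V * K₁)) +
            ∑ j, β j • (K j * V * K j) = E := by
  obtain ⟨U, t, hUU, hUU', hEU⟩ := hE.exists_unitary_diagonal
  have htr : ∀ s : Fin d → ℝ,
      (U * diagonal (fun i ↦ (s i : ℂ)) * Uᴴ).trace = ((∑ i, s i : ℝ) : ℂ) := by
    intro s
    rw [trace_mul_comm, ← Matrix.mul_assoc, hUU, Matrix.one_mul, trace_diagonal]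
    push_cast
    rfl
  have ht : ∑ i, t i = 0 := by
    rw [hEU, htr] at hEtr
    exact_mod_cast hEtr
  obtain ⟨m, hm, s, β, hs, hsum⟩ := Submodule.exists_sum_smul_eq_of_mem_span
    (mem_span_balanced_of_sum_eq_zero hdeven t ht)
  have hK : ∀ j, ∃ K : Matrix (Fin d) (Fin d) ℂ, K.IsHermitian ∧ K * K = 1 ∧
      K * V * K = U * diagonal (fun i ↦ (s j i : ℂ)) * Uᴴ := by
    intro j
    refine exists_involution_conj_eq hV hV2 hVtr ?_ ?_ ?_
    · refine isHermitian_mul_mul_conjTranspose U (isHermitian_diagonal_of_self_adjoint _ ?_)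
      ext i
      simp
    · have hD : diagonal (fun i ↦ (s j i : ℂ)) * diagonal (fun i ↦ (s j i : ℂ)) = 1 := by
        rw [diagonal_mul_diagonal, ← diagonal_one]
        congr 1
        ext i
        rcases (hs j).1 i with h | h <;> simp [h]
      calc _ = U * (diagonal (fun i ↦ (s j i : ℂ)) * (Uᴴ * U) *
            diagonal (fun i ↦ (s j i : ℂ))) * Uᴴ := by simp only [Matrix.mul_assoc]
        _ = 1 := by rw [hUU, Matrix.mul_one, hD, Matrix.mul_one, hUU']
    · rw [htr, (hs j).2, Complex.ofReal_zero]
  choose K hKH hK2 hKV using hK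
  rw [Module.finrank_fin_fun] at hm
  refine ⟨m, by omega, 1, K, 0, 0, β, isHermitian_one, one_mul 1, hKH, hK2, ?_⟩
  rw [zero_smul, zero_smul, zero_add, zero_add, hEU, ← hsum]
  simp_rw [hKV]
  have hdiag : diagonal (fun i ↦ (((∑ j, β j • s j) i : ℝ) : ℂ)) =
      ∑ j, β j • diagonal (fun i ↦ (s j i : ℂ)) := by
    ext a b
    rcases eq_or_ne a b with rfl | hab
    · simp [Matrix.sum_apply]
    · simp [Matrix.sum_apply, hab]
  rw [hdiag, Matrix.mul_sum, Matrix.sum_mul]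
  simp only [Matrix.mul_smul, Matrix.smul_mul]
end

section
/- Let n ≥ 1, let u, v ∈ ℂⁿ be unit vectors, and set Y = u v† (a rank-one partial isometry). Define the 2n×2n block matrices K = [[I − u u†, u v†], [v u†, −(I − v v†)]] and V = [[I, 0], [0, −I]]. Then K is Hermitian with K² = I, the off-diagonal blocks of K V K vanish, and K V K = [[I − 2 u u†, 0], [0, −I + 2 v v†]]. -/
open Matrix

theorem star_dotProduct_self_eq_one {ι : Type*} [Fintype ι] {w : ι → ℂ}
    (hw : ∑ i, ‖w i‖ ^ 2 = 1) : star w ⬝ᵥ w = 1 := by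
  simp only [dotProduct, Pi.star_apply, RCLike.star_def, Complex.conj_mul']
  exact_mod_cast hw

theorem vecMulVec_star_mul_vecMulVec {l m k : Type*} [Fintype m] {w : m → ℂ}
    (hw : star w ⬝ᵥ w = 1) (a : l → ℂ) (b : k → ℂ) :
    vecMulVec a (star w) * vecMulVec w b = vecMulVec a b := by
  rw [vecMulVec_mul_vecMulVec, hw, one_smul]

/-- **Rank-one partial isometry correctors.** For unit vectors `u, v ∈ ℂⁿ` and
`Y = u v†`, the block matrix `K = [[I − uu†, uv†], [vu†, −(I − vv†)]]` is a Hermitian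
involution, the off-diagonal blocks of `K V K` (with `V = [[I,0],[0,−I]]`) vanish, and
`K V K = [[I − 2uu†, 0], [0, −I + 2vv†]]`. -/
theorem rank_one_corrector_blocks
    (n : ℕ) (hn : 1 ≤ n) (u v : Fin n → ℂ)
    (hu : ∑ i, ‖u i‖ ^ 2 = 1) (hv : ∑ i, ‖v i‖ ^ 2 = 1) :
    let K : Matrix (Fin n ⊕ Fin n) (Fin n ⊕ Fin n) ℂ :=
      Matrix.fromBlocks (1 - Matrix.vecMulVec u (star u)) (Matrix.vecMulVec u (star v))
        (Matrix.vecMulVec v (star u)) (-(1 - Matrix.vecMulVec v (star v)))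
    let V : Matrix (Fin n ⊕ Fin n) (Fin n ⊕ Fin n) ℂ :=
      Matrix.fromBlocks 1 0 0 (-1)
    K.IsHermitian ∧ K * K = 1 ∧
      (K * V * K).toBlocks₁₂ = 0 ∧ (K * V * K).toBlocks₂₁ = 0 ∧
      K * V * K =
        Matrix.fromBlocks (1 - (2 : ℂ) • Matrix.vecMulVec u (star u)) 0 0
          (-1 + (2 : ℂ) • Matrix.vecMulVec v (star v)) := by
  intro K V
  have hu' := star_dotProduct_self_eq_one hu
  have hv' := star_dotProduct_self_eq_one hv
  have hKVK : K * V * K =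
      Matrix.fromBlocks (1 - (2 : ℂ) • Matrix.vecMulVec u (star u)) 0 0
        (-1 + (2 : ℂ) • Matrix.vecMulVec v (star v)) := by
    simp only [K, V, fromBlocks_multiply, fromBlocks_inj, mul_one, mul_zero, add_zero, zero_add,
      mul_neg, neg_mul, neg_neg, sub_mul, mul_sub, one_mul, two_smul,
      vecMulVec_star_mul_vecMulVec hu', vecMulVec_star_mul_vecMulVec hv']
    refine ⟨?_, ?_, ?_, ?_⟩ <;> abel
  refine ⟨?_, ?_, ?_, ?_, hKVK⟩
  · simp [K, IsHermitian, fromBlocks_conjTranspose, conjTranspose_vecMulVec]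
  · rw [← fromBlocks_one]
    simp only [K, fromBlocks_multiply, fromBlocks_inj, mul_one,
      mul_neg, neg_mul, sub_mul, mul_sub, one_mul,
      vecMulVec_star_mul_vecMulVec hu', vecMulVec_star_mul_vecMulVec hv']
    refine ⟨?_, ?_, ?_, ?_⟩ <;> abel
  · rw [hKVK, toBlocks_fromBlocks₁₂]
  · rw [hKVK, toBlocks_fromBlocks₂₁]
end

section
/- Let n ≥ 1 and let A, D ∈ M_n(ℂ) be positive semidefinite with tr A = tr D = S > 0. Then there exist an integer m ≤ 2n − 1, positive reals w_1, …, w_m with ∑_j w_j = S, and unit vectors u_1, …, u_m and v_1, …, v_m in ℂⁿ such that A = ∑_{j=1}^m w_j · u_j u_j† and D = ∑_{j=1}^m w_j · v_j v_j† (a shared-weights rank-one decomposition obtained from the common refinement of the spectral cumulative sums of A and D). -/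
open Matrix
open scoped ComplexOrder

/-- The weighted sum of the values of `f` over a list of weighted points. -/
def weightedSum {α M : Type*} [AddCommGroup M] [Module ℝ M] (f : α → M)
    (l : List (ℝ × α)) : M :=
  (l.map fun p => p.1 • f p.2).sum

section weightedSum

variable {α β M N : Type*} [AddCommGroup M] [Module ℝ M] [AddCommGroup N] [Module ℝ N]

@[simp]
theorem weightedSum_nil (f : α → M) : weightedSum f [] = 0 := by
  simp [weightedSum]

@[simp]
theorem weightedSum_cons (f : α → M) (p : ℝ × α) (l : List (ℝ × α)) :
    weightedSum f (p :: l) = p.1 • f p.2 + weightedSum f l := by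
  simp [weightedSum]

theorem weightedSum_ofFn {n : ℕ} (f : α → M) (w : Fin n → ℝ) (x : Fin n → α) :
    weightedSum f (List.ofFn fun i => (w i, x i)) = ∑ i, w i • f (x i) := by
  simp [weightedSum, List.map_ofFn, List.sum_ofFn]

theorem weightedSum_eq_sum_get (f : α → M) (l : List (ℝ × α)) :
    weightedSum f l = ∑ j, (l.get j).1 • f (l.get j).2 := by
  conv_lhs => rw [← List.ofFn_get l]
  exact weightedSum_ofFn f (fun j => (l.get j).1) fun j => (l.get j).2

theorem weightedSum_eq_zero_of_forall_fst_eq_zero (f : α → M) {l : List (ℝ × α)}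
    (hl : ∀ p ∈ l, p.1 = 0) : weightedSum f l = 0 := by
  refine List.sum_eq_zero fun x hx => ?_
  obtain ⟨p, hp, rfl⟩ := List.mem_map.1 hx
  simp [hl p hp]

/-- Two lists of weighted points admit a coupling by positively weighted pairs with fewer
entries than the two lists together. -/
def HasShortCoupling (f : α → M) (g : β → N) (la : List (ℝ × α)) (lb : List (ℝ × β)) : Prop :=
  ∃ L : List (ℝ × α × β), L.length ≤ la.length + lb.length - 1 ∧ (∀ p ∈ L, 0 < p.1) ∧
    (L.map Prod.fst).sum = (la.map Prod.fst).sum ∧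
    weightedSum (fun p : α × β => f p.1) L = weightedSum f la ∧
    weightedSum (fun p : α × β => g p.2) L = weightedSum g lb

theorem HasShortCoupling.symm {f : α → M} {g : β → N} {la : List (ℝ × α)} {lb : List (ℝ × β)}
    (hsum : (la.map Prod.fst).sum = (lb.map Prod.fst).sum) (h : HasShortCoupling f g la lb) :
    HasShortCoupling g f lb la := by
  obtain ⟨L, hlen, hpos, hL, hf, hg⟩ := h
  refine ⟨L.map fun p => (p.1, p.2.swap), by simpa [add_comm] using hlen, ?_, ?_, ?_, ?_⟩
  · exact List.forall_mem_map.2 hpos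
  · rw [← hsum, ← hL, List.map_map]
    rfl
  · rw [← hg]
    simp [weightedSum, Function.comp_def]
  · rw [← hf]
    simp [weightedSum, Function.comp_def]

theorem hasShortCoupling_nil (f : α → M) (g : β → N) {lb : List (ℝ × β)}
    (hb : ∀ p ∈ lb, 0 ≤ p.1) (hsum : (lb.map Prod.fst).sum = 0) :
    HasShortCoupling f g [] lb := by
  refine ⟨[], by simp, by simp, by simp, by simp, ?_⟩
  rw [weightedSum_nil, weightedSum_eq_zero_of_forall_fst_eq_zero]
  exact fun p hp => List.all_zero_of_le_zero_le_of_sum_eq_zero (List.forall_mem_map.2 hb) hsum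
    (List.mem_map_of_mem hp)

theorem HasShortCoupling.cons {f : α → M} {g : β → N} {la : List (ℝ × α)} {lb : List (ℝ × β)}
    {a b : ℝ} {x : α} {y : β} (ha : 0 ≤ a)
    (h : HasShortCoupling f g la ((b - a, y) :: lb)) :
    HasShortCoupling f g ((a, x) :: la) ((b, y) :: lb) := by
  obtain ⟨L, hlen, hpos, hL, hf, hg⟩ := h
  simp only [List.length_cons] at hlen
  rcases ha.eq_or_lt with rfl | ha
  · exact ⟨L, by simp only [List.length_cons]; omega, hpos, by simpa using hL, by simpa using hf,
      by simpa using hg⟩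
  · refine ⟨(a, x, y) :: L, by simp only [List.length_cons]; omega, ?_, by simp [hL],
      by simp [hf], ?_⟩
    · simpa [ha] using fun c x y h => hpos (c, x, y) h
    · simp only [weightedSum_cons, hg, sub_smul]
      abel

theorem hasShortCoupling_of_sum_eq (f : α → M) (g : β → N) (la : List (ℝ × α))
    (lb : List (ℝ × β)) (ha : ∀ p ∈ la, 0 ≤ p.1) (hb : ∀ p ∈ lb, 0 ≤ p.1)
    (hsum : (la.map Prod.fst).sum = (lb.map Prod.fst).sum) : HasShortCoupling f g la lb := by
  match la, lb with
  | [], lb => exact hasShortCoupling_nil f g hb (by simpa using hsum.symm)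
  | p :: la, [] =>
    exact (hasShortCoupling_nil g f ha (by simpa using hsum)).symm hsum.symm
  | (a, x) :: la, (b, y) :: lb =>
    have hsum' := hsum
    simp only [List.map_cons, List.sum_cons] at hsum'
    simp only [List.forall_mem_cons] at ha hb
    rcases le_total a b with hab | hab
    · refine (hasShortCoupling_of_sum_eq f g la ((b - a, y) :: lb) ha.2 ?_ ?_).cons ha.1
      · simp only [List.forall_mem_cons]
        exact ⟨sub_nonneg.2 hab, hb.2⟩
      · simp only [List.map_cons, List.sum_cons]
        linarith
    · have hsum'' : (((a - b, x) :: la).map Prod.fst).sum = (lb.map Prod.fst).sum := by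
        simp only [List.map_cons, List.sum_cons]
        linarith
      refine HasShortCoupling.symm hsum.symm (HasShortCoupling.cons hb.1
        (HasShortCoupling.symm hsum''
          (hasShortCoupling_of_sum_eq f g ((a - b, x) :: la) lb ?_ hb.2 hsum'')))
      simp only [List.forall_mem_cons]
      exact ⟨sub_nonneg.2 hab, ha.2⟩
termination_by la.length + lb.length

end weightedSum

/-- A positive semidefinite matrix is a nonnegative combination of rank-one projections, as many
as its size, with weights summing to its trace. -/
theorem Matrix.PosSemidef.exists_eq_sum_smul_vecMulVec {n : ℕ} {A : Matrix (Fin n) (Fin n) ℂ}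
    (hA : A.PosSemidef) :
    ∃ (w : Fin n → ℝ) (u : Fin n → Fin n → ℂ), (∀ i, 0 ≤ w i) ∧ ((∑ i, w i : ℝ) : ℂ) = A.trace ∧
      (∀ i, ∑ k, ‖u i k‖ ^ 2 = 1) ∧ A = ∑ i, w i • vecMulVec (u i) (star (u i)) := by
  refine ⟨hA.1.eigenvalues, fun i => hA.1.eigenvectorBasis i, hA.eigenvalues_nonneg, ?_, ?_, ?_⟩
  · rw [hA.1.trace_eq_sum_eigenvalues]
    simp
  · intro i
    rw [← EuclideanSpace.norm_sq_eq, hA.1.eigenvectorBasis.norm_eq_one, one_pow]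
  · conv_lhs => rw [hA.1.spectral_theorem]
    ext a b
    simp [Unitary.conjStarAlgAut_apply, Matrix.mul_apply, Matrix.sum_apply, vecMulVec_apply,
      diagonal_apply]
    exact Finset.sum_congr rfl fun i _ => by ring

/-- **Shared-weights rank-one decomposition.** For positive semidefinite `A, D ∈ M_n(ℂ)`
with `tr A = tr D = S > 0`, there exist `m ≤ 2n − 1` positive weights summing to `S` and
unit vectors `u_j, v_j` with `A = ∑ w_j u_j u_j†` and `D = ∑ w_j v_j v_j†`. -/
theorem shared_weights_rank_one_decomposition
    (n : ℕ) (hn : 1 ≤ n) (A D : Matrix (Fin n) (Fin n) ℂ)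
    (hA : A.PosSemidef) (hD : D.PosSemidef)
    (S : ℝ) (hS : 0 < S)
    (htrA : A.trace = (S : ℂ)) (htrD : D.trace = (S : ℂ)) :
    ∃ (m : ℕ), m ≤ 2 * n - 1 ∧
      ∃ (w : Fin m → ℝ) (u v : Fin m → Fin n → ℂ),
        (∀ j, 0 < w j) ∧ (∑ j, w j) = S ∧
        (∀ j, ∑ i, ‖u j i‖ ^ 2 = 1) ∧ (∀ j, ∑ i, ‖v j i‖ ^ 2 = 1) ∧
        A = ∑ j, (w j : ℂ) • Matrix.vecMulVec (u j) (star (u j)) ∧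
        D = ∑ j, (w j : ℂ) • Matrix.vecMulVec (v j) (star (v j)) := by
  obtain ⟨wA, uA, hwA, hsA, huA, hAeq⟩ := hA.exists_eq_sum_smul_vecMulVec
  obtain ⟨wD, uD, hwD, hsD, huD, hDeq⟩ := hD.exists_eq_sum_smul_vecMulVec
  have hsumA : ∑ i, wA i = S := by exact_mod_cast hsA.trans htrA
  have hsumD : ∑ i, wD i = S := by exact_mod_cast hsD.trans htrD
  obtain ⟨L, hlen, hpos, hL, hLA, hLD⟩ := hasShortCoupling_of_sum_eq
    (fun i => vecMulVec (uA i) (star (uA i))) (fun i => vecMulVec (uD i) (star (uD i)))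
    (List.ofFn fun i => (wA i, i)) (List.ofFn fun i => (wD i, i))
    (by simpa [List.mem_ofFn] using hwA) (by simpa [List.mem_ofFn] using hwD)
    (by simp [List.map_ofFn, List.sum_ofFn, hsumA, hsumD])
  rw [weightedSum_ofFn, weightedSum_eq_sum_get] at hLA hLD
  refine ⟨L.length, by simpa [two_mul] using hlen, fun j => (L.get j).1,
    fun j => uA (L.get j).2.1, fun j => uD (L.get j).2.2, fun j => hpos _ (L.get_mem j), ?_,
    fun j => huA _, fun j => huD _, ?_, ?_⟩
  · rw [← hsumA, ← List.sum_ofFn, ← List.sum_ofFn]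
    rw [List.map_ofFn] at hL
    simpa [Function.comp_def, List.ofFn_getElem_eq_map] using hL
  · simp only [Complex.coe_smul]
    exact hAeq.trans hLA.symm
  · simp only [Complex.coe_smul]
    exact hDeq.trans hLD.symm
end
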